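/- Let β ≥ 1 and let μ be a positive Borel measure on R^{n+1}_+ such that μ(TB) ≤ C |B|^β for all balls B ⊆ R^n. Then there is a constant C' < ∞, depending only on C, n and β, such that μ(TO) ≤ C' |O|^β for every open set O ⊆ R^n of finite Lebesgue measure. -/

import Mathlib

open MeasureTheory Metric Set ENNReal Filter

noncomputable section

/-- The tent over a set `E`: points `(x,t)` with `x ∈ E`, `0 < t`, and `t < dist(x, ∂E)`. -/
def tent {X : Type*} [MetricSpace X] (E : Set X) : Set (X × ℝ) :=
  {p | p.1 ∈ E ∧ 0 < p.2 ∧ p.2 < Metric.infDist p.1 (frontier E)}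

/-- Euclidean space `ℝ^n`. -/
abbrev En (n : ℕ) := EuclideanSpace ℝ (Fin n)

/-- Superadditivity of `x ↦ x ^ β` for `β ≥ 1`. -/
theorem tsum_rpow_le_rpow_tsum {ι : Type*} (a : ι → ℝ≥0∞) {β : ℝ} (hβ : 1 ≤ β) :
    ∑' i, a i ^ β ≤ (∑' i, a i) ^ β := by
  have split (x : ℝ≥0∞) : x ^ β = x * x ^ (β - 1) := by
    conv_lhs => rw [← add_sub_cancel 1 β]
    rw [ENNReal.rpow_add_of_nonneg _ _ zero_le_one (sub_nonneg.2 hβ), ENNReal.rpow_one]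
  calc ∑' i, a i ^ β ≤ ∑' i, a i * (∑' j, a j) ^ (β - 1) := by
        refine ENNReal.tsum_le_tsum fun i => ?_
        rw [split]
        gcongr
        exact ENNReal.le_tsum i
    _ = (∑' i, a i) ^ β := by rw [ENNReal.tsum_mul_right, ← split]

theorem ball_infDist_frontier_subset {E : Type*} [NormedAddCommGroup E] [NormedSpace ℝ E]
    {O : Set E} (hO : IsOpen O) {x : E} (hx : x ∈ O) :
    ball x (infDist x (frontier O)) ⊆ O := by
  rcases le_or_gt (infDist x (frontier O)) 0 with h | h
  · simp [ball_eq_empty.2 h]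
  refine isPreconnected_ball.subset_left_of_subset_union hO isClosed_closure.isOpen_compl
    (disjoint_compl_right.mono_left subset_closure) (fun y hy => ?_) ⟨x, mem_ball_self h, hx⟩
  by_contra hn
  simp only [mem_union, mem_compl_iff, not_or, not_not] at hn
  have hf : y ∈ frontier O := by rw [hO.frontier_eq]; exact ⟨hn.2, hn.1⟩
  have := infDist_le_dist_of_mem (x := x) hf
  rw [mem_ball'] at hy
  linarith

theorem mem_tent_ball {E : Type*} [NormedAddCommGroup E] [NormedSpace ℝ E] [Nontrivial E]
    {x z : E} {t R : ℝ} (ht : 0 < t) (h : dist x z + t < R) : (x, t) ∈ tent (ball z R) := by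
  have hR : 0 < R := by linarith [dist_nonneg (x := x) (y := z)]
  refine ⟨mem_ball.2 (by dsimp only; linarith), ht, ?_⟩
  have hle : R - dist x z ≤ infDist x (frontier (ball z R)) := by
    rw [frontier_ball z hR.ne', le_infDist (NormedSpace.sphere_nonempty.2 hR.le)]
    intro w hw
    linarith [mem_sphere.1 hw, dist_triangle_left w z x]
  dsimp only
  linarith

/-- Vitali covering of a tent over an open set of finite measure by tents over enlargements of
disjoint balls contained in the set. -/
theorem exists_tent_subset_biUnion {E : Type*} [NormedAddCommGroup E] [NormedSpace ℝ E]
    [FiniteDimensional ℝ E] [Nontrivial E] [MeasurableSpace E] [BorelSpace E]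
    (ν : Measure E) [ν.IsAddHaarMeasure] {O : Set E} (hO : IsOpen O) (hfin : ν O < ⊤) :
    ∃ (u : Set E) (r : E → ℝ), (∀ y ∈ u, 0 < r y ∧ closedBall y (r y) ⊆ O) ∧
      u.PairwiseDisjoint (fun y => closedBall y (r y)) ∧
      tent O ⊆ ⋃ y ∈ u, tent (ball y (12 * r y)) := by
  set d : E → ℝ := fun x => infDist x (frontier O)
  have hsub (x : E) (hx : x ∈ O) (hd : 0 < d x) : closedBall x (d x / 2) ⊆ O :=
    (closedBall_subset_ball (by linarith)).trans (ball_infDist_frontier_subset hO hx)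
  have hv0 : ν (ball (0 : E) 1) ≠ 0 := (measure_ball_pos ν 0 one_pos).ne'
  have hbdd : ∀ x ∈ {x ∈ O | 0 < d x}, d x / 2 ≤ max 1 (ν O / ν (ball (0 : E) 1)).toReal := by
    rintro x ⟨hx, hd⟩
    rcases le_total (d x / 2) 1 with h1 | h1
    · exact h1.trans (le_max_left _ _)
    refine (le_self_pow₀ h1 (Module.finrank_pos (R := ℝ) (M := E)).ne').trans
      (le_trans ?_ (le_max_right _ _))
    rw [← ENNReal.ofReal_le_iff_le_toReal (ENNReal.div_lt_top hfin.ne hv0).ne,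
      ENNReal.le_div_iff_mul_le (Or.inl hv0) (Or.inl measure_ball_lt_top.ne),
      ← ν.addHaar_closedBall x (half_pos hd).le]
    exact measure_mono (hsub x hx hd)
  obtain ⟨u, hut, hdisj, hcov⟩ := Vitali.exists_disjoint_subfamily_covering_enlargement_closedBall
    {x ∈ O | 0 < d x} id (fun x => d x / 2) _ hbdd 5 (by norm_num)
  refine ⟨u, fun x => d x / 2, fun y hy => ⟨half_pos (hut hy).2, hsub y (hut hy).1 (hut hy).2⟩,
    hdisj, ?_⟩
  rintro ⟨x, t⟩ ⟨hx, ht, htd⟩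
  dsimp only at hx ht htd
  obtain ⟨y, hy, hxy⟩ := hcov x ⟨hx, ht.trans htd⟩
  have hdist : dist x y ≤ 5 * (d y / 2) :=
    mem_closedBall.1 (hxy (mem_closedBall_self (half_pos (ht.trans htd)).le))
  have hlip : d x ≤ d y + dist x y := infDist_le_infDist_add_dist
  have htd' : t < d x := htd
  exact mem_biUnion hy (mem_tent_ball ht (by linarith))

/-- if `β ≥ 1` and `μ(TB) ≤ C |B|^β` for all balls `B ⊆ ℝ^n`, then there is
`C'` depending only on `C`, `n`, `β` with `μ(TO) ≤ C' |O|^β` for all open `O` of finite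
Lebesgue measure. -/
theorem stmt2 (n : ℕ) (hn : 0 < n) (β : ℝ) (hβ : 1 ≤ β) (C : ℝ) (hC : 0 < C) :
    ∃ C' : ℝ, 0 < C' ∧ ∀ μ : Measure (En n × ℝ),
      (∀ (z : En n) (r : ℝ), 0 < r →
        μ (tent (ball z r)) ≤ ENNReal.ofReal (C * (volume (ball z r)).toReal ^ β)) →
      ∀ O : Set (En n), IsOpen O → volume O < ⊤ →
        μ (tent O) ≤ ENNReal.ofReal (C' * (volume O).toReal ^ β) := by
  have hβ0 : 0 ≤ β := zero_le_one.trans hβ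
  refine ⟨C * ((12 : ℝ) ^ n) ^ β, by positivity, fun μ hμ O hO hfin => ?_⟩
  have : Nonempty (Fin n) := ⟨⟨0, hn⟩⟩
  obtain ⟨u, r, hu, hdisj, hcov⟩ := exists_tent_subset_biUnion volume hO hfin
  have hcount : u.Countable := hdisj.countable_of_nonempty_interior fun y hy =>
    (nonempty_ball.2 (hu y hy).1).mono ball_subset_interior_closedBall
  have hball (y : En n) (hy : y ∈ u) : μ (tent (ball y (12 * r y))) ≤
      ENNReal.ofReal (C * ((12 : ℝ) ^ n) ^ β) * volume (closedBall y (r y)) ^ β := by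
    have hr := (hu y hy).1
    refine (hμ y _ (by positivity)).trans_eq ?_
    have hvol : volume (ball y (12 * r y)) =
        ENNReal.ofReal (12 ^ n) * volume (closedBall y (r y)) := by
      rw [Measure.addHaar_ball_mul_of_pos _ _ (by norm_num), finrank_euclideanSpace_fin,
        Measure.addHaar_closedBall_eq_addHaar_ball, Measure.addHaar_ball_center _ y]
    rw [hvol, ENNReal.toReal_mul, ENNReal.toReal_ofReal (by positivity),
      Real.mul_rpow (by positivity) ENNReal.toReal_nonneg, ← mul_assoc,
      ENNReal.ofReal_mul (by positivity),
      ← ENNReal.ofReal_rpow_of_nonneg ENNReal.toReal_nonneg hβ0,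
      ENNReal.ofReal_toReal measure_closedBall_lt_top.ne]
  calc μ (tent O) ≤ ∑' y : u, μ (tent (ball (y : En n) (12 * r y))) :=
        (measure_mono hcov).trans (measure_biUnion_le μ hcount _)
    _ ≤ ∑' y : u, ENNReal.ofReal (C * ((12 : ℝ) ^ n) ^ β) *
          volume (closedBall (y : En n) (r y)) ^ β :=
        ENNReal.tsum_le_tsum fun y => hball y y.2
    _ ≤ ENNReal.ofReal (C * ((12 : ℝ) ^ n) ^ β) *
          (∑' y : u, volume (closedBall (y : En n) (r y))) ^ β := by
        rw [ENNReal.tsum_mul_left]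
        gcongr
        exact tsum_rpow_le_rpow_tsum _ hβ
    _ ≤ ENNReal.ofReal (C * ((12 : ℝ) ^ n) ^ β) * volume O ^ β := by
        gcongr
        rw [← measure_biUnion hcount hdisj fun _ _ => isClosed_closedBall.measurableSet]
        exact measure_mono (iUnion₂_subset fun y hy => (hu y hy).2)
    _ = ENNReal.ofReal (C * ((12 : ℝ) ^ n) ^ β * (volume O).toReal ^ β) := by
        rw [ENNReal.ofReal_mul (p := C * ((12 : ℝ) ^ n) ^ β) (by positivity),
          ← ENNReal.ofReal_rpow_of_nonneg ENNReal.toReal_nonneg hβ0,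
          ENNReal.ofReal_toReal hfin.ne]

end
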